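/- Micro-local defect measure of an L²-concentration in space: let χ ∈ C_c^∞(ℝ^n), x₀ ∈ ℝ^n, and set f_j(x) = j^{n/2} χ(j(x − x₀)) for j ∈ ℕ. Then for every zero-homogeneous symbol a, ℓ(a, f_j) → ∫_{ℝ^n ∖ {0}} a(x₀, ξ/|ξ|) |χ̂(ξ)|² dξ as j → ∞; that is, the micro-local defect measure of (f_j) is δ_{x₀}(x) ⊗ d_χ(ω) dσ(ω), where σ is the surface measure on S^{n−1} and d_χ(ω) = ∫_0^∞ |χ̂(rω)|² r^{n−1} dr. -/

import Mathlib

open MeasureTheory Filter Topology Complex FourierTransform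
open scoped RealInnerProductSpace ContDiff

noncomputable section

abbrev Rn (n : ℕ) := EuclideanSpace ℝ (Fin n)
abbrev Sph (n : ℕ) := Metric.sphere (0 : Rn n) 1

/-- A zero-homogeneous symbol `a : ℝⁿ × Sⁿ⁻¹ → ℂ`: jointly continuous (the case `k = 0`
below), smooth in the first variable, with all `x`-derivatives jointly continuous, and
compactly supported in the first variable. -/
structure ZeroHomSymbol (n : ℕ) where
  toFun : Rn n → Sph n → ℂ
  smooth_x : ∀ w : Sph n, ContDiff ℝ ∞ fun x => toFun x w
  derivs_continuous : ∀ k : ℕ,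
    Continuous fun p : Rn n × Sph n => iteratedFDeriv ℝ k (fun x => toFun x p.2) p.1
  compactly_supported : ∃ R : ℝ, ∀ (x : Rn n) (w : Sph n), R < ‖x‖ → toFun x w = 0

open scoped Classical in
/-- The direction `ξ/|ξ| ∈ Sⁿ⁻¹` of a nonzero vector (junk value at `ξ = 0`). -/
def dirOf {n : ℕ} [NeZero n] (ξ : Rn n) : Sph n :=
  if h : ξ = 0 then ⟨EuclideanSpace.single 0 1, by simp [EuclideanSpace.norm_single]⟩
  else ⟨‖ξ‖⁻¹ • ξ, by
    have hξ : ‖ξ‖ ≠ 0 := norm_ne_zero_iff.mpr h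
    simp [mem_sphere_zero_iff_norm, norm_smul, Real.norm_eq_abs, abs_inv, abs_norm,
      inv_mul_cancel₀ hξ]⟩

/-- Partial Fourier transform in the first variable of a zero-homogeneous symbol:
`â₁(η, ω) = ∫ a(x, ω) e^{-2πi x·η} dx`. -/
def symbFT {n : ℕ} (a : ZeroHomSymbol n) (η : Rn n) (w : Sph n) : ℂ :=
  𝓕 (fun x => a.toFun x w) η

/-- The quadratic form `ℓ(a, f) = (Op(a) f, f)_{L²}` of the zero-homogeneous quantization,
realized as the absolutely convergent integral
`∫∫ â₁(η, ξ/|ξ|) f̂(ξ) conj(f̂(ξ+η)) dξ dη`. -/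
def ellQF {n : ℕ} [NeZero n] (a : ZeroHomSymbol n) (f : Rn n → ℂ) : ℂ :=
  ∫ η : Rn n, ∫ ξ : Rn n,
    symbFT a η (dirOf ξ) * 𝓕 f ξ * (starRingEnd ℂ) (𝓕 f (ξ + η))


lemma dirOf_smul {n : ℕ} [NeZero n] {t : ℝ} (ht : 0 < t) (ξ : Rn n) :
    dirOf (t • ξ) = dirOf ξ := by
  by_cases h : ξ = 0
  · simp [h]
  · have h' : t • ξ ≠ 0 := smul_ne_zero ht.ne' h
    apply Subtype.ext
    simp only [dirOf, h, h', dite_false, norm_smul, Real.norm_eq_abs, abs_of_pos ht, smul_smul]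
    congr 1
    field_simp

lemma measurable_dirOf {n : ℕ} [NeZero n] : Measurable (dirOf : Rn n → Sph n) := by
  classical
  refine Measurable.subtype_mk (f := fun ξ : Rn n => (dirOf ξ : Rn n)) ?_ (h := fun ξ => (dirOf ξ).2)
  have : (fun ξ : Rn n => (dirOf ξ : Rn n)) =
      fun ξ => if ξ = 0 then EuclideanSpace.single 0 1 else ‖ξ‖⁻¹ • ξ := by
    funext ξ
    by_cases h : ξ = 0 <;> simp [dirOf, h]
  rw [this]
  exact Measurable.ite (measurableSet_singleton 0) measurable_const (by fun_prop)

lemma measurable_comp_dirOf {n : ℕ} [NeZero n] {g : Rn n → Sph n → ℂ}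
    (hg : Measurable fun p : Rn n × Sph n => g p.1 p.2) :
    Measurable fun p : Rn n × Rn n => g p.1 (dirOf p.2) := by
  have hpair : Measurable fun p : Rn n × Rn n => ((p.1, dirOf p.2) : Rn n × Sph n) :=
    measurable_fst.prodMk (measurable_dirOf.comp measurable_snd)
  exact hg.comp hpair

namespace ZeroHomSymbol

variable {n : ℕ} (a : ZeroHomSymbol n)

lemma continuous_uncurry : Continuous fun p : Rn n × Sph n => a.toFun p.1 p.2 := by
  have h := a.derivs_continuous 0
  have := (continuousMultilinearCurryFin0 ℝ (Rn n) ℂ).continuous.comp h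
  exact this.congr fun p => by simp

lemma exists_iteratedFDeriv_eq_zero : ∃ R : ℝ, ∀ (k : ℕ) (w : Sph n) (x : Rn n),
    x ∉ Metric.closedBall (0 : Rn n) R → iteratedFDeriv ℝ k (fun x => a.toFun x w) x = 0 := by
  obtain ⟨R, hR⟩ := a.compactly_supported
  refine ⟨R, fun k w x hx => ?_⟩
  by_contra h
  refine hx ((closure_minimal (fun y hy => ?_) Metric.isClosed_closedBall)
    (support_iteratedFDeriv_subset (𝕜 := ℝ) k (Function.mem_support.mpr h)))
  by_contra hyR
  exact hy (hR y w (by simpa using hyR))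

lemma hasCompactSupport (w : Sph n) : HasCompactSupport fun x => a.toFun x w := by
  obtain ⟨R, hR⟩ := a.compactly_supported
  refine HasCompactSupport.of_support_subset_isCompact (isCompact_closedBall (0 : Rn n) R) ?_
  intro y hy
  by_contra hyR
  exact hy (hR y w (by simpa using hyR))

/-- The Schwartz function `x ↦ a(x, w)`. -/
def slice (w : Sph n) : SchwartzMap (Rn n) ℂ := (a.hasCompactSupport w).toSchwartzMap (a.smooth_x w)

lemma continuous_symbFT : Continuous fun p : Rn n × Sph n => symbFT a p.1 p.2 := by
  obtain ⟨R, hR⟩ := a.compactly_supported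
  have key : ∀ p : Rn n × Sph n, symbFT a p.1 p.2 =
      ∫ x in Metric.closedBall (0 : Rn n) R, 𝐞 (-⟪x, p.1⟫) • a.toFun x p.2 := by
    intro p
    rw [symbFT, Real.fourier_eq, setIntegral_eq_integral_of_forall_compl_eq_zero]
    intro x hx
    rw [hR x p.2 (by simpa using hx), smul_zero]
  simp_rw [key]
  refine continuous_parametric_integral_of_continuous ?_ (isCompact_closedBall _ _)
  have h1 : Continuous fun q : (Rn n × Sph n) × Rn n => a.toFun q.2 q.1.2 :=
    a.continuous_uncurry.comp (by fun_prop : Continuous fun q : (Rn n × Sph n) × Rn n => (q.2, q.1.2))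
  have h2 : Continuous fun q : (Rn n × Sph n) × Rn n => 𝐞 (-⟪q.2, q.1.1⟫) :=
    Real.continuous_fourierChar.comp (by fun_prop)
  exact h2.smul h1

lemma measurable_symbFT_dirOf [NeZero n] :
    Measurable fun p : Rn n × Rn n => symbFT a p.1 (dirOf p.2) :=
  measurable_comp_dirOf (g := symbFT a) a.continuous_symbFT.measurable

lemma exists_integral_norm_iteratedFDeriv_le (k : ℕ) : ∃ C : ℝ, ∀ w : Sph n,
    ∫ x, ‖iteratedFDeriv ℝ k (fun x => a.toFun x w) x‖ ≤ C := by
  obtain ⟨R, hR⟩ := a.exists_iteratedFDeriv_eq_zero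
  obtain ⟨M, hM⟩ := ((isCompact_closedBall (0 : Rn n) R).prod
    (isCompact_univ (X := Sph n))).bddAbove_image (a.derivs_continuous k).norm.continuousOn
  refine ⟨M * volume.real (Metric.closedBall (0 : Rn n) R), fun w => ?_⟩
  rw [← setIntegral_eq_integral_of_forall_compl_eq_zero
    (s := Metric.closedBall (0 : Rn n) R) (fun x hx => by rw [hR k w x hx, norm_zero])]
  refine (Real.le_norm_self _).trans
    (norm_setIntegral_le_of_norm_le_const measure_closedBall_lt_top fun x hx => ?_)
  rw [norm_norm]
  exact hM ⟨(x, w), ⟨hx, trivial⟩, rfl⟩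

lemma exists_pow_mul_norm_symbFT_le (k : ℕ) : ∃ C : ℝ, ∀ (η : Rn n) (w : Sph n),
    ‖η‖ ^ k * ‖symbFT a η w‖ ≤ C := by
  choose C hC using a.exists_integral_norm_iteratedFDeriv_le
  refine ⟨2 ^ k * ∑ i ∈ Finset.range (k + 1), C i, fun η w => ?_⟩
  have h := Real.pow_mul_norm_iteratedFDeriv_fourier_le (K := ⊤) (N := ⊤) (a.smooth_x w)
    (fun k n _ _ => (a.slice w).integrable_pow_mul_iteratedFDeriv volume k n)
    (k := 0) (n := k) le_top le_top η
  simp only [norm_iteratedFDeriv_zero, pow_zero, one_mul, CharP.cast_eq_zero, mul_zero, zero_add,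
    Finset.range_one, Finset.sum_product, Finset.sum_singleton] at h
  refine h.trans ?_
  gcongr
  exact hC _ w

lemma exists_norm_symbFT_le : ∃ C : ℝ, ∀ (η : Rn n) (w : Sph n),
    ‖symbFT a η w‖ ≤ C * (1 + ‖η‖) ^ (-(n + 1 : ℝ)) := by
  obtain ⟨C₀, h₀⟩ := a.exists_pow_mul_norm_symbFT_le 0
  obtain ⟨C₁, h₁⟩ := a.exists_pow_mul_norm_symbFT_le (n + 1)
  refine ⟨2 ^ n * (C₀ + C₁), fun η w => ?_⟩
  have hpos : 0 < 1 + ‖η‖ := by positivity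
  rw [Real.rpow_neg hpos.le, ← div_eq_mul_inv, le_div_iff₀ (by positivity)]
  have hcast : (1 + ‖η‖) ^ (n + 1 : ℝ) = (1 + ‖η‖) ^ (n + 1) := by
    exact_mod_cast Real.rpow_natCast (1 + ‖η‖) (n + 1)
  have hp := add_pow_le zero_le_one (norm_nonneg η) (n + 1)
  rw [one_pow, Nat.add_sub_cancel] at hp
  rw [hcast]
  calc ‖symbFT a η w‖ * (1 + ‖η‖) ^ (n + 1)
      ≤ ‖symbFT a η w‖ * (2 ^ n * (1 + ‖η‖ ^ (n + 1))) := by gcongr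
    _ = 2 ^ n * (‖η‖ ^ 0 * ‖symbFT a η w‖ + ‖η‖ ^ (n + 1) * ‖symbFT a η w‖) := by ring
    _ ≤ 2 ^ n * (C₀ + C₁) := by gcongr; exacts [h₀ η w, h₁ η w]

/-- Fourier inversion in the first variable. -/
lemma integral_fourierChar_mul_symbFT (x : Rn n) (w : Sph n) :
    ∫ η, (𝐞 ⟪η, x⟫ : ℂ) * symbFT a η w = a.toFun x w := by
  have h := (a.smooth_x w).continuous.fourierInv_fourier_eq (a.slice w).integrable
    (𝓕 (a.slice w)).integrable
  have hx := congrFun h x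
  rw [Real.fourierInv_eq] at hx
  simpa only [Circle.smul_def, smul_eq_mul, symbFT] using hx

end ZeroHomSymbol

/-- The Fourier transform of an `L²`-normalized dilation followed by a translation. -/
lemma fourier_dilation {n : ℕ} (χ : Rn n → ℂ) (x₀ : Rn n) {t : ℝ} (ht : 0 < t) (ξ : Rn n) :
    𝓕 (fun x => ((t ^ ((n : ℝ) / 2) : ℝ) : ℂ) * χ (t • (x - x₀))) ξ =
      ((t ^ (-((n : ℝ) / 2)) : ℝ) : ℂ) * (𝐞 (-⟪x₀, ξ⟫) : ℂ) * 𝓕 χ (t⁻¹ • ξ) := by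
  have hc : t ^ ((n : ℝ) / 2) * (t ^ n)⁻¹ = t ^ (-((n : ℝ) / 2)) := by
    rw [← Real.rpow_natCast, ← Real.rpow_neg ht.le, ← Real.rpow_add ht]
    congr 1; ring
  rw [Real.fourier_eq, Real.fourier_eq, ← integral_add_right_eq_self _ x₀]
  have h := Measure.integral_comp_smul (μ := (volume : Measure (Rn n)))
    (fun y : Rn n => 𝐞 (-⟪y, t⁻¹ • ξ⟫) • χ y) t
  rw [finrank_euclideanSpace_fin, abs_of_pos (by positivity)] at h
  have e : ∀ y : Rn n, 𝐞 (-⟪y + x₀, ξ⟫) •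
      (((t ^ ((n : ℝ) / 2) : ℝ) : ℂ) * χ (t • (y + x₀ - x₀))) =
      (((t ^ ((n : ℝ) / 2) : ℝ) : ℂ) * (𝐞 (-⟪x₀, ξ⟫) : ℂ)) *
        (𝐞 (-⟪t • y, t⁻¹ • ξ⟫) • χ (t • y)) := by
    intro y
    have hi : ⟪t • y, t⁻¹ • ξ⟫ = ⟪y, ξ⟫ := by
      rw [real_inner_smul_left, real_inner_smul_right, mul_inv_cancel_left₀ ht.ne']
    rw [hi, inner_add_left, neg_add, AddChar.map_add_eq_mul, add_sub_cancel_right]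
    simp only [Circle.smul_def, smul_eq_mul, Circle.coe_mul]
    ring
  simp_rw [e]
  rw [integral_const_mul, h, Complex.real_smul, ← hc]
  push_cast
  ring

/-- After rescaling the frequency variable, the integrand of `ellQF a (f_j)`. -/
lemma ellQF_dilation {n : ℕ} [NeZero n] (a : ZeroHomSymbol n) (χ : Rn n → ℂ) (x₀ : Rn n)
    {t : ℝ} (ht : 0 < t) :
    ellQF a (fun x => ((t ^ ((n : ℝ) / 2) : ℝ) : ℂ) * χ (t • (x - x₀))) =
      ∫ η : Rn n, ∫ ξ : Rn n, (𝐞 ⟪η, x₀⟫ : ℂ) * symbFT a η (dirOf ξ) * 𝓕 χ ξ *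
        (starRingEnd ℂ) (𝓕 χ (ξ + t⁻¹ • η)) := by
  unfold ellQF
  congr 1
  funext η
  have h := Measure.integral_comp_smul (μ := (volume : Measure (Rn n)))
    (fun ξ : Rn n => (𝐞 ⟪η, x₀⟫ : ℂ) * symbFT a η (dirOf ξ) * 𝓕 χ ξ *
        (starRingEnd ℂ) (𝓕 χ (ξ + t⁻¹ • η))) t⁻¹
  rw [finrank_euclideanSpace_fin, abs_of_pos (by positivity)] at h
  have hc : t ^ (-((n : ℝ) / 2)) * t ^ (-((n : ℝ) / 2)) = (t ^ n)⁻¹ := by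
    rw [← Real.rpow_natCast, ← Real.rpow_neg ht.le, ← Real.rpow_add ht]
    congr 1; ring
  have e : ∀ ξ : Rn n, symbFT a η (dirOf ξ) *
      𝓕 (fun x => ((t ^ ((n : ℝ) / 2) : ℝ) : ℂ) * χ (t • (x - x₀))) ξ *
      (starRingEnd ℂ) (𝓕 (fun x => ((t ^ ((n : ℝ) / 2) : ℝ) : ℂ) * χ (t • (x - x₀))) (ξ + η)) =
      (((t ^ n)⁻¹ : ℝ) : ℂ) * ((𝐞 ⟪η, x₀⟫ : ℂ) * symbFT a η (dirOf (t⁻¹ • ξ)) * 𝓕 χ (t⁻¹ • ξ) *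
        (starRingEnd ℂ) (𝓕 χ (t⁻¹ • ξ + t⁻¹ • η))) := by
    intro ξ
    have hphase : (𝐞 (-⟪x₀, ξ⟫) : ℂ) * (starRingEnd ℂ) (𝐞 (-⟪x₀, ξ + η⟫) : ℂ) = 𝐞 ⟪η, x₀⟫ := by
      rw [← Circle.coe_inv_eq_conj, ← AddChar.map_neg_eq_inv, ← Circle.coe_mul,
        ← AddChar.map_add_eq_mul, inner_add_right, real_inner_comm η x₀]
      congr 2; ring
    rw [fourier_dilation χ x₀ ht, fourier_dilation χ x₀ ht, dirOf_smul (inv_pos.mpr ht), ← hc,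
      ← hphase, smul_add]
    simp only [map_mul, Complex.conj_ofReal]
    push_cast
    ring
  simp_rw [e]
  rw [integral_const_mul, h, Complex.real_smul, ← mul_assoc, ← Complex.ofReal_mul]
  have : (t ^ n)⁻¹ * ((t⁻¹ ^ n)⁻¹) = 1 := by
    rw [inv_pow, inv_inv, inv_mul_cancel₀ (by positivity)]
  rw [this, Complex.ofReal_one, one_mul]

/-- Micro-local defect measure of an `L²`-concentration in space: for
`f_j(x) = j^{n/2} χ(j(x − x₀))` with `χ ∈ C_c^∞(ℝⁿ)`, one has, for every zero-homogeneous
symbol `a`, `ℓ(a, f_j) → ∫_{ξ ≠ 0} a(x₀, ξ/|ξ|) |χ̂(ξ)|² dξ`; i.e. the micro-local defect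
measure of `(f_j)` is `δ_{x₀} ⊗ d_χ(ω) dσ(ω)`. -/
theorem microlocal_defect_measure_of_concentration_in_space
    (n : ℕ) [NeZero n] (χ : Rn n → ℂ) (hχ : ContDiff ℝ ∞ χ) (hχc : HasCompactSupport χ)
    (x₀ : Rn n) (f : ℕ → Rn n → ℂ)
    (hf : ∀ (j : ℕ) (x : Rn n),
      f j x = ((j : ℝ) ^ ((n : ℝ) / 2) : ℝ) * χ ((j : ℝ) • (x - x₀))) :
    ∀ a : ZeroHomSymbol n,
      Tendsto (fun j => ellQF a (f j)) atTop
        (𝓝 (∫ ξ in {(0 : Rn n)}ᶜ,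
          a.toFun x₀ (dirOf ξ) * ((‖𝓕 χ ξ‖ ^ 2 : ℝ) : ℂ))) := by
  intro a
  obtain ⟨X, hX⟩ : ∃ X : SchwartzMap (Rn n) ℂ, ∀ ξ, 𝓕 χ ξ = X ξ :=
    ⟨𝓕 (hχc.toSchwartzMap hχ), fun _ => rfl⟩
  obtain ⟨C, hC⟩ := a.exists_norm_symbFT_le
  obtain ⟨M, hM⟩ : ∃ M : ℝ, ∀ ξ, ‖X ξ‖ ≤ M := by
    obtain ⟨M, hM⟩ := X.decay 0 0
    exact ⟨M, fun ξ => by simpa using hM.2 ξ⟩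
  -- the rescaled integrands, as functions on the product space
  let F : ℝ → Rn n × Rn n → ℂ := fun s p =>
    (𝐞 ⟪p.1, x₀⟫ : ℂ) * symbFT a p.1 (dirOf p.2) * X p.2 * (starRingEnd ℂ) (X (p.2 + s • p.1))
  let B : Rn n × Rn n → ℝ := fun p => (C * (1 + ‖p.1‖) ^ (-(n + 1 : ℝ))) * (‖X p.2‖ * M)
  have hB : Integrable B (volume.prod volume) := by
    refine Integrable.mul_prod ((integrable_one_add_norm ?_).const_mul C)
      (X.integrable.norm.mul_const M)
    rw [finrank_euclideanSpace_fin]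
    linarith
  have hFm : ∀ s, AEStronglyMeasurable (F s) (volume.prod volume) := by
    intro s
    have h1 := a.measurable_symbFT_dirOf
    have h2 : Continuous fun p : Rn n × Rn n => (𝐞 ⟪p.1, x₀⟫ : ℂ) :=
      continuous_subtype_val.comp (Real.continuous_fourierChar.comp (by fun_prop))
    have h3 : Continuous fun p : Rn n × Rn n => X p.2 := X.continuous.comp (by fun_prop)
    have h4 : Continuous fun p : Rn n × Rn n => (starRingEnd ℂ) (X (p.2 + s • p.1)) :=
      Complex.continuous_conj.comp (X.continuous.comp (by fun_prop))
    exact (((h2.measurable.mul h1).mul h3.measurable).mul h4.measurable).aestronglyMeasurable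
  have hFB : ∀ s p, ‖F s p‖ ≤ B p := by
    intro s p
    simp only [F, B, norm_mul, Circle.norm_coe, one_mul, RCLike.norm_conj]
    rw [mul_assoc]
    gcongr
    · exact (norm_nonneg _).trans (hC p.1 (dirOf p.2))
    · exact hC _ _
    · exact hM _
  have hFi : ∀ s, Integrable (F s) (volume.prod volume) := fun s =>
    hB.mono' (hFm s) (Eventually.of_forall (hFB s))
  have hlim : Tendsto (fun j : ℕ => ∫ p, F ((j : ℝ)⁻¹) p ∂(volume.prod volume)) atTop
      (𝓝 (∫ p, F 0 p ∂(volume.prod volume))) := by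
    refine tendsto_integral_of_dominated_convergence B (fun j => hFm _) hB
      (fun j => Eventually.of_forall (hFB _)) (Eventually.of_forall fun p => ?_)
    have hcont : Continuous fun s : ℝ => F s p :=
      continuous_const.mul (Complex.continuous_conj.comp (X.continuous.comp (by fun_prop)))
    exact (hcont.tendsto 0).comp tendsto_inv_atTop_nhds_zero_nat
  have hF0 : ∫ p, F 0 p ∂(volume.prod volume) =
      ∫ ξ in {(0 : Rn n)}ᶜ, a.toFun x₀ (dirOf ξ) * ((‖𝓕 χ ξ‖ ^ 2 : ℝ) : ℂ) := by
    have hnull : ({(0 : Rn n)}ᶜ : Set (Rn n)) =ᵐ[volume] Set.univ := by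
      rw [ae_eq_univ, compl_compl]
      exact measure_singleton 0
    rw [integral_prod_symm _ (hFi 0), setIntegral_congr_set hnull, setIntegral_univ]
    congr 1
    funext ξ
    rw [← a.integral_fourierChar_mul_symbFT x₀ (dirOf ξ), ← integral_mul_const]
    congr 1
    funext η
    simp only [F, zero_smul, add_zero]
    rw [mul_assoc _ (X ξ), Complex.mul_conj, Complex.normSq_eq_norm_sq, hX]
  rw [← hF0]
  refine hlim.congr' ?_
  filter_upwards [eventually_gt_atTop 0] with j hj
  have hfj : f j = fun x => (((j : ℝ) ^ ((n : ℝ) / 2) : ℝ) : ℂ) * χ ((j : ℝ) • (x - x₀)) :=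
    funext (hf j)
  rw [hfj, ellQF_dilation a χ x₀ (Nat.cast_pos.mpr hj), integral_prod _ (hFi _)]
  simp only [F, hX]

end
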